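/- Let k ≥ 2 and m₁,…,m_k ≥ 1 and m = m₁ + ⋯ + m_k. The map p sending a point ((x_{1,1},…,x_{m₁,1},q₁),…,(x_{1,k},…,x_{m_k,k},q_k)) of S^{m₁} × ⋯ × S^{m_k} (where q_i denotes the last coordinate of the i-th factor) to the unit vector (x_{1,1},…,x_{m₁,1},…,x_{1,k},…,x_{m_k,k}, q₁q₂⋯q_k)/√(Σ_{i,j} x_{j,i}² + (q₁q₂⋯q_k)²) ∈ S^m ⊂ ℝ^{m+1} is continuous, surjective, constant on G_k-orbits, and the induced map from the orbit space (S^{m₁} × ⋯ × S^{m_k})/G_k to S^m is a homeomorphism. -/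

import Mathlib

open scoped BigOperators

noncomputable section

/-- The orbit relation of the group `G_k` of orientation-preserving sign changes acting
componentwise on `S^{m₁} × ⋯ × S^{m_k}`: the `i`-th sign `ε i ∈ {±1}` flips the last
coordinate of the `i`-th sphere factor, and the product of the signs equals `1`. -/
def signRel (k : ℕ) (m : Fin k → ℕ)
    (a b : ∀ i : Fin k, {y : EuclideanSpace ℝ (Fin (m i + 1)) // ‖y‖ = 1}) : Prop :=
  ∃ ε : Fin k → ℝ, (∀ i, ε i = 1 ∨ ε i = -1) ∧ (∏ i, ε i) = 1 ∧
    ∀ i : Fin k, ∀ j : Fin (m i + 1),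
      (b i).1 j = if j = Fin.last (m i) then ε i * (a i).1 j else (a i).1 j

/-- The ambient Euclidean space `ℝ^{m₁} × ⋯ × ℝ^{m_k} × ℝ ≅ ℝ^{m+1}` with its `L²`-norm,
containing the target sphere `S^m`, `m = m₁ + ⋯ + m_k`. -/
abbrev RTarget (k : ℕ) (m : Fin k → ℕ) : Type :=
  WithLp 2 ((PiLp 2 fun i : Fin k => EuclideanSpace ℝ (Fin (m i))) × ℝ)

/-- The unnormalized vector `(x_{1,1}, …, x_{m₁,1}, …, x_{1,k}, …, x_{m_k,k}, q₁q₂⋯q_k)`,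
where `q_i` is the last coordinate of the `i`-th sphere factor. -/
def rVec (k : ℕ) (m : Fin k → ℕ)
    (a : ∀ i : Fin k, {y : EuclideanSpace ℝ (Fin (m i + 1)) // ‖y‖ = 1}) : RTarget k m :=
  (WithLp.equiv 2 _).symm
    ((WithLp.equiv 2 _).symm
        (fun i => (WithLp.equiv 2 _).symm fun j : Fin (m i) => (a i).1 j.castSucc),
      ∏ i, (a i).1 (Fin.last (m i)))

/-- The normalized map `p` of Statement 1. -/
def rProj (k : ℕ) (m : Fin k → ℕ)
    (a : ∀ i : Fin k, {y : EuclideanSpace ℝ (Fin (m i + 1)) // ‖y‖ = 1}) : RTarget k m :=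
  ‖rVec k m a‖⁻¹ • rVec k m a

lemma norm_head_sq_add_last_sq {n : ℕ} (y : EuclideanSpace ℝ (Fin (n + 1))) :
    ‖WithLp.toLp 2 (fun j : Fin n => y j.castSucc)‖ ^ 2 + y (Fin.last n) ^ 2 = ‖y‖ ^ 2 := by
  simp [EuclideanSpace.norm_sq_eq, Fin.sum_univ_castSucc]

/-- Extend a vector by a last coordinate. -/
def snocVec {n : ℕ} (x : EuclideanSpace ℝ (Fin n)) (q : ℝ) : EuclideanSpace ℝ (Fin (n + 1)) :=
  WithLp.toLp 2 (Fin.snoc (α := fun _ => ℝ) x.ofLp q)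

@[simp] lemma snocVec_castSucc {n : ℕ} (x : EuclideanSpace ℝ (Fin n)) (q : ℝ) (j : Fin n) :
    snocVec x q j.castSucc = x j := by
  simp [snocVec]

@[simp] lemma snocVec_last {n : ℕ} (x : EuclideanSpace ℝ (Fin n)) (q : ℝ) :
    snocVec x q (Fin.last n) = q := by
  simp [snocVec]

lemma norm_snocVec {n : ℕ} (x : EuclideanSpace ℝ (Fin n)) (q : ℝ) (h : ‖x‖ ^ 2 + q ^ 2 = 1) :
    ‖snocVec x q‖ = 1 := by
  have := norm_head_sq_add_last_sq (snocVec x q)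
  simp only [snocVec_castSucc, snocVec_last] at this
  have h2 : ‖snocVec x q‖ ^ 2 = 1 := by rw [← this]; exact h
  exact (pow_eq_one_iff_of_nonneg (norm_nonneg _) two_ne_zero).1 h2

section
variable {k : ℕ} {m : Fin k → ℕ}
  {a b : ∀ i : Fin k, {y : EuclideanSpace ℝ (Fin (m i + 1)) // ‖y‖ = 1}}

lemma norm_rVec_fst_sq (a : ∀ i : Fin k, {y : EuclideanSpace ℝ (Fin (m i + 1)) // ‖y‖ = 1})
    (i : Fin k) : ‖(rVec k m a).fst i‖ ^ 2 + (a i).1 (Fin.last (m i)) ^ 2 = 1 := by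
  have h := norm_head_sq_add_last_sq (a i).1
  rw [(a i).2, one_pow] at h
  exact h

lemma rVec_ne_zero (a : ∀ i : Fin k, {y : EuclideanSpace ℝ (Fin (m i + 1)) // ‖y‖ = 1}) :
    rVec k m a ≠ 0 := by
  intro h
  have hq : ∏ i, (a i).1 (Fin.last (m i)) = 0 := congrArg WithLp.snd h
  obtain ⟨i, -, hi⟩ := Finset.prod_eq_zero_iff.1 hq
  have := norm_rVec_fst_sq a i
  simp [h, hi] at this

lemma continuous_rVec : Continuous (rVec k m) := by
  unfold rVec
  simp only [WithLp.equiv_symm_apply]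
  fun_prop

lemma rVec_congr_of_signRel (h : signRel k m a b) : rVec k m a = rVec k m b := by
  obtain ⟨ε, -, hp, hε⟩ := h
  have hq : ∏ i, (b i).1 (Fin.last (m i)) = ∏ i, (a i).1 (Fin.last (m i)) := by
    simp [hε, Finset.prod_mul_distrib, hp]
  have hx (i : Fin k) (j : Fin (m i)) : (b i).1 j.castSucc = (a i).1 j.castSucc := by
    simp [hε, (Fin.castSucc_lt_last j).ne]
  simp only [rVec, hq, hx]

lemma abs_last_eq_sqrt (a : ∀ i : Fin k, {y : EuclideanSpace ℝ (Fin (m i + 1)) // ‖y‖ = 1})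
    (i : Fin k) : |(a i).1 (Fin.last (m i))| = √(1 - ‖(rVec k m a).fst i‖ ^ 2) := by
  rw [← eq_sub_of_add_eq' (norm_rVec_fst_sq a i), Real.sqrt_sq_eq_abs]

lemma le_one_of_rVec_eq_smul {c : ℝ} (hc : 0 < c) (h : rVec k m a = c • rVec k m b) : c ≤ 1 := by
  by_contra! hc1
  have hx (i : Fin k) : ‖(rVec k m a).fst i‖ = c * ‖(rVec k m b).fst i‖ := by
    rw [h, WithLp.smul_fst, PiLp.smul_apply, norm_smul, Real.norm_of_nonneg hc.le]
  have hq : ∏ i, (a i).1 (Fin.last (m i)) = c * ∏ i, (b i).1 (Fin.last (m i)) :=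
    congrArg WithLp.snd h
  have hle : |∏ i, (a i).1 (Fin.last (m i))| ≤ |∏ i, (b i).1 (Fin.last (m i))| := by
    rw [Finset.abs_prod, Finset.abs_prod]
    refine Finset.prod_le_prod (fun _ _ => abs_nonneg _) fun i _ => ?_
    rw [abs_last_eq_sqrt, abs_last_eq_sqrt, hx]
    gcongr
    exact le_mul_of_one_le_left (norm_nonneg _) hc1.le
  rw [hq, abs_mul, abs_of_pos hc] at hle
  have h0 : ∏ i, (b i).1 (Fin.last (m i)) = 0 := by
    by_contra hne
    nlinarith [abs_pos.2 hne]
  obtain ⟨i, -, hi⟩ := Finset.prod_eq_zero_iff.1 h0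
  have hb := norm_rVec_fst_sq b i
  have ha := norm_rVec_fst_sq a i
  rw [hx] at ha
  rw [hi, zero_pow two_ne_zero, add_zero] at hb
  rw [mul_pow, hb, mul_one] at ha
  nlinarith [sq_nonneg ((a i).1 (Fin.last (m i)))]

lemma rVec_eq_of_rProj_eq (h : rProj k m a = rProj k m b) : rVec k m a = rVec k m b := by
  have key {a b : ∀ i : Fin k, {y : EuclideanSpace ℝ (Fin (m i + 1)) // ‖y‖ = 1}}
      (h : rProj k m a = rProj k m b) : ‖rVec k m a‖ ≤ ‖rVec k m b‖ := by
    have ha := norm_pos_iff.2 (rVec_ne_zero a)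
    have hb := norm_pos_iff.2 (rVec_ne_zero b)
    have := le_one_of_rVec_eq_smul (a := a) (b := b) (c := ‖rVec k m a‖ / ‖rVec k m b‖)
      (by positivity) (by
        rw [div_eq_mul_inv, mul_smul]
        exact (inv_smul_eq_iff₀ ha.ne').1 h)
    exact (div_le_one hb).1 this
  have hn := (key h).antisymm (key h.symm)
  have h' := h
  rw [rProj, rProj, hn] at h'
  exact smul_right_injective _ (inv_ne_zero (norm_ne_zero_iff.2 (rVec_ne_zero b))) h'

lemma exists_sign_prod_eq_one {ι : Type*} [Fintype ι] {p q : ι → ℝ} (h : ∀ i, |q i| = |p i|)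
    (hpq : ∏ i, q i = ∏ i, p i) :
    ∃ ε : ι → ℝ, (∀ i, ε i = 1 ∨ ε i = -1) ∧ ∏ i, ε i = 1 ∧ ∀ i, q i = ε i * p i := by
  classical
  have h1 (i : ι) : ∃ e : ℝ, (e = 1 ∨ e = -1) ∧ q i = e * p i := by
    rcases abs_eq_abs.1 (h i) with h | h
    · exact ⟨1, by simp, by simp [h]⟩
    · exact ⟨-1, by simp, by simp [h]⟩
  choose ε hε hq using h1
  by_cases hp : ∏ i, p i = 0
  · obtain ⟨j, -, hj⟩ := Finset.prod_eq_zero_iff.1 hp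
    have hP : ∏ i ∈ Finset.univ.erase j, ε i = 1 ∨ ∏ i ∈ Finset.univ.erase j, ε i = -1 := by
      refine Finset.prod_induction ε (fun x => x = 1 ∨ x = -1) ?_ (by simp) fun i _ => hε i
      rintro x y (rfl | rfl) (rfl | rfl) <;> simp
    refine ⟨Function.update ε j (∏ i ∈ Finset.univ.erase j, ε i), fun i => ?_, ?_, fun i => ?_⟩
    · by_cases hij : i = j
      · subst hij; simpa using hP
      · simpa [hij] using hε i
    · rw [Finset.prod_update_of_mem (Finset.mem_univ j), ← Finset.erase_eq]
      rcases hP with h | h <;> simp [h]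
    · by_cases hij : i = j
      · subst hij; simp [hq, hj]
      · simpa [hij] using hq i
  · refine ⟨ε, hε, ?_, hq⟩
    simp only [hq, Finset.prod_mul_distrib] at hpq
    exact mul_right_cancel₀ hp (by rw [hpq, one_mul])

lemma signRel_of_rVec_eq (h : rVec k m a = rVec k m b) : signRel k m a b := by
  obtain ⟨ε, hε, hp, hq⟩ := exists_sign_prod_eq_one
    (p := fun i => (a i).1 (Fin.last (m i))) (q := fun i => (b i).1 (Fin.last (m i)))
    (fun i => by rw [abs_last_eq_sqrt, abs_last_eq_sqrt, h]) (congrArg WithLp.snd h).symm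
  refine ⟨ε, hε, hp, fun i j => ?_⟩
  induction j using Fin.lastCases with
  | last => simpa using hq i
  | cast j =>
    rw [if_neg (Fin.castSucc_lt_last j).ne]
    exact (congrArg (fun v : RTarget k m => v.fst i j) h).symm

/-- Scaling by some `t > 0` makes a nonzero tuple `(r, s)` with `r ≥ 0` satisfy
`|s| = ∏ i, √(1 - r i ^ 2)`. -/
lemma exists_pos_mul_eq_prod_sqrt {ι : Type*} [Fintype ι] (r : ι → ℝ) (hr : ∀ i, 0 ≤ r i) (s : ℝ)
    (h : s ≠ 0 ∨ ∃ i, r i ≠ 0) :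
    ∃ t : ℝ, 0 < t ∧ (∀ i, (t * r i) ^ 2 ≤ 1) ∧ t * |s| = ∏ i, √(1 - (t * r i) ^ 2) := by
  by_cases hs : s = 0
  · obtain ⟨i₀, hi₀⟩ := h.resolve_left (not_not.2 hs)
    obtain ⟨i, -, hi⟩ := Finset.exists_max_image Finset.univ r ⟨i₀, Finset.mem_univ _⟩
    have hpos : 0 < r i :=
      (lt_of_le_of_ne (hr i₀) hi₀.symm).trans_le (hi i₀ (Finset.mem_univ _))
    refine ⟨(r i)⁻¹, inv_pos.2 hpos, fun j => ?_, ?_⟩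
    · refine pow_le_one₀ (mul_nonneg (inv_nonneg.2 hpos.le) (hr j)) ?_
      rw [inv_mul_le_one₀ hpos]
      exact hi j (Finset.mem_univ _)
    · rw [hs, abs_zero, mul_zero, eq_comm, Finset.prod_eq_zero_iff]
      exact ⟨i, Finset.mem_univ _, by simp [hpos.ne']⟩
  · have hs' : 0 < |s| := abs_pos.2 hs
    have hcont : Continuous fun t : ℝ => t * |s| - ∏ i, √(1 - (t * r i) ^ 2) := by fun_prop
    obtain ⟨t, ⟨ht0, -⟩, ht⟩ := intermediate_value_Icc (inv_nonneg.2 hs'.le)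
      hcont.continuousOn (show (0 : ℝ) ∈ _ from ⟨by simp, by
        simp only [inv_mul_cancel₀ hs'.ne', sub_nonneg]
        refine Finset.prod_le_one (fun _ _ => Real.sqrt_nonneg _) fun i _ => ?_
        rw [Real.sqrt_le_one]
        linarith [sq_nonneg (|s|⁻¹ * r i)]⟩)
    have ht' := sub_eq_zero.1 ht
    have htpos : 0 < t := by
      refine lt_of_le_of_ne ht0 ?_
      rintro rfl
      simp at ht'
    refine ⟨t, htpos, fun i => ?_, ht'⟩
    by_contra! hlt
    have : ∏ i, √(1 - (t * r i) ^ 2) = 0 :=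
      Finset.prod_eq_zero (Finset.mem_univ i) (Real.sqrt_eq_zero_of_nonpos (by linarith))
    rw [this] at ht'
    exact (mul_pos htpos hs').ne' ht'

lemma exists_abs_eq_prod_eq {ι : Type*} [Fintype ι] {c : ι → ℝ} {s : ℝ} (hc : ∀ i, 0 ≤ c i)
    (h : |s| = ∏ i, c i) (hι : s < 0 → Nonempty ι) :
    ∃ q : ι → ℝ, (∀ i, |q i| = c i) ∧ ∏ i, q i = s := by
  classical
  rcases le_or_gt 0 s with hs | hs
  · exact ⟨c, fun i => abs_of_nonneg (hc i), by rw [← h, abs_of_nonneg hs]⟩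
  · obtain ⟨j⟩ := hι hs
    refine ⟨Function.update c j (-c j), fun i => ?_, ?_⟩
    · by_cases hij : i = j
      · subst hij; simpa using hc i
      · simpa [hij] using hc i
    · rw [Finset.prod_update_of_mem (Finset.mem_univ j), neg_mul, ← Finset.erase_eq,
        Finset.mul_prod_erase _ _ (Finset.mem_univ j), ← h, abs_of_neg hs, neg_neg]

lemma exists_rVec_eq_smul (hk : 0 < k) {y : RTarget k m} (hy : y ≠ 0) :
    ∃ a, ∃ t : ℝ, 0 < t ∧ rVec k m a = t • y := by
  obtain ⟨t, ht, hle, hprod⟩ := exists_pos_mul_eq_prod_sqrt (fun i => ‖y.fst i‖)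
    (fun i => norm_nonneg _) y.snd (by
      by_contra! hne
      refine hy (WithLp.ofLp_injective 2 (Prod.ext ?_ hne.1))
      ext i : 1
      exact norm_eq_zero.1 (hne.2 i))
  obtain ⟨q, hq, hqs⟩ := exists_abs_eq_prod_eq (s := t * y.snd) (fun i => Real.sqrt_nonneg _)
    (by rw [abs_mul, abs_of_pos ht, hprod]) fun _ => ⟨(⟨0, hk⟩ : Fin k)⟩
  refine ⟨fun i => ⟨snocVec (t • y.fst i) (q i), norm_snocVec _ _ ?_⟩, t, ht, ?_⟩
  · rw [norm_smul, Real.norm_of_nonneg ht.le, ← sq_abs (q i), hq,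
      Real.sq_sqrt (sub_nonneg.2 (hle i)), add_sub_cancel]
  · refine WithLp.ofLp_injective 2 (Prod.ext ?_ ?_)
    · ext i j
      simp [rVec]
    · simpa [rVec] using hqs

lemma continuous_rProj : Continuous (rProj k m) :=
  (continuous_rVec.norm.inv₀ fun a => norm_ne_zero_iff.2 (rVec_ne_zero a)).smul continuous_rVec

lemma norm_rProj (a : ∀ i : Fin k, {y : EuclideanSpace ℝ (Fin (m i + 1)) // ‖y‖ = 1}) :
    ‖rProj k m a‖ = 1 := by
  rw [rProj, norm_smul, norm_inv, norm_norm,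
    inv_mul_cancel₀ (norm_ne_zero_iff.2 (rVec_ne_zero a))]

lemma exists_rProj_eq (hk : 0 < k) {y : RTarget k m} (hy : ‖y‖ = 1) : ∃ a, rProj k m a = y := by
  obtain ⟨a, t, ht, h⟩ := exists_rVec_eq_smul hk (y := y) (by rintro rfl; simp at hy)
  refine ⟨a, ?_⟩
  rw [rProj, h, norm_smul, hy, mul_one, Real.norm_of_nonneg ht.le, inv_smul_smul₀ ht.ne']

lemma rProj_eq_of_signRel (h : signRel k m a b) : rProj k m a = rProj k m b := by
  rw [rProj, rProj, rVec_congr_of_signRel h]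

end

/-- `p` is continuous, takes values in the unit sphere `S^m`, is surjective onto
`S^m`, is constant on `G_k`-orbits, and induces a homeomorphism
`(S^{m₁} × ⋯ × S^{m_k})/G_k ≃ₜ S^m`. -/
theorem stmt1 (k : ℕ) (hk : 2 ≤ k) (m : Fin k → ℕ) (hm : ∀ i, 1 ≤ m i) :
    Continuous (rProj k m) ∧
    (∀ a, ‖rProj k m a‖ = 1) ∧
    (∀ y : RTarget k m, ‖y‖ = 1 → ∃ a, rProj k m a = y) ∧
    (∀ a b, signRel k m a b → rProj k m a = rProj k m b) ∧
    ∃ h : Quot (signRel k m) ≃ₜ Metric.sphere (0 : RTarget k m) 1,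
      ∀ a, (h (Quot.mk _ a)).1 = rProj k m a := by
  refine ⟨continuous_rProj, norm_rProj, fun y => exists_rProj_eq (by omega),
    fun a b => rProj_eq_of_signRel, ?_⟩
  have (n : ℕ) : CompactSpace {y : EuclideanSpace ℝ (Fin n) // ‖y‖ = 1} := by
    have h : IsCompact {y : EuclideanSpace ℝ (Fin n) | ‖y‖ = 1} := by
      have hs : {y : EuclideanSpace ℝ (Fin n) | ‖y‖ = 1} = Metric.sphere 0 1 :=
        Set.ext fun y => mem_sphere_zero_iff_norm.symm
      rw [hs]
      exact isCompact_sphere _ _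
    exact isCompact_iff_compactSpace.1 h
  let f : Quot (signRel k m) → Metric.sphere (0 : RTarget k m) 1 :=
    Quot.lift (fun a => ⟨rProj k m a, by simp [norm_rProj]⟩)
      fun a b h => Subtype.ext (rProj_eq_of_signRel h)
  have hf : Continuous f := continuous_quot_lift _ (continuous_rProj.subtype_mk _)
  have hbij : Function.Bijective f := by
    constructor
    · rintro ⟨a⟩ ⟨b⟩ h
      exact Quot.sound (signRel_of_rVec_eq (rVec_eq_of_rProj_eq (congrArg Subtype.val h)))
    · rintro ⟨y, hy⟩
      obtain ⟨a, ha⟩ := exists_rProj_eq (k := k) (m := m) (y := y) (by omega) (by simpa using hy)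
      exact ⟨Quot.mk _ a, Subtype.ext ha⟩
  exact ⟨Continuous.homeoOfEquivCompactToT2 (f := Equiv.ofBijective f hbij) hf, fun a => rfl⟩
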